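/- Let f₁, f₂ : ℝⁿ → ℝ be CPWL functions with minimal depths m₁ and m₂ respectively. If f₁ + f₂ has minimal depth m, then either m = max(m₁, m₂), or m ≤ m₁ and m₁ = m₂. -/

import Mathlib

open Pointwise

noncomputable section

/-- `NN m n` is the set of functions `ℝⁿ → ℝ` representable by a ReLU neural network
with `m` hidden layers: `f = T⁽ᵐ⁺¹⁾ ∘ σ ∘ T⁽ᵐ⁾ ∘ σ ∘ ⋯ ∘ σ ∘ T⁽¹⁾` with each `T⁽ˡ⁾` affine
and `σ` the componentwise ReLU.  (`NN 0 n` is the set of affine functions.) -/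
def NN : ℕ → (n : ℕ) → Set ((Fin n → ℝ) → ℝ)
  | 0, n => {f | ∃ T : (Fin n → ℝ) →ᵃ[ℝ] ℝ, f = ⇑T}
  | m + 1, n => {f | ∃ (w : ℕ) (T : (Fin n → ℝ) →ᵃ[ℝ] (Fin w → ℝ)),
      ∃ g ∈ NN m w, f = fun x => g fun i => max (T x i) 0}

/-- Continuous piecewise linear functions `ℝⁿ → ℝ`: continuous functions that at each point
agree with one of finitely many affine functions. -/
def CPWL (n : ℕ) : Set ((Fin n → ℝ) → ℝ) :=
  {f | Continuous f ∧ ∃ s : Finset ((Fin n → ℝ) →ᵃ[ℝ] ℝ), ∀ x, ∃ g ∈ s, f x = g x}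

/-- `f` has minimal depth `m`: `f ∈ Υₙ(m)` and either `m = 0` or `f ∉ Υₙ(m-1)`. -/
def MinDepth (n : ℕ) (f : (Fin n → ℝ) → ℝ) (m : ℕ) : Prop :=
  f ∈ NN m n ∧ (m = 0 ∨ f ∉ NN (m - 1) n)

/-- `Mn n` is the least `m` such that `Υₙ = Υₙ(m)`. -/
def Mn (n : ℕ) : ℕ := sInf {m | CPWL n = NN m n}

theorem NN.comp_affineMap {m n k : ℕ} {f : (Fin n → ℝ) → ℝ} (hf : f ∈ NN m n)
    (A : (Fin k → ℝ) →ᵃ[ℝ] (Fin n → ℝ)) : (fun x => f (A x)) ∈ NN m k := by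
  cases m with
  | zero =>
    obtain ⟨T, rfl⟩ := hf
    exact ⟨T.comp A, rfl⟩
  | succ m =>
    obtain ⟨w, T, g, hg, rfl⟩ := hf
    exact ⟨w, T.comp A, g, hg, rfl⟩

theorem NN.neg {m n : ℕ} {f : (Fin n → ℝ) → ℝ} (hf : f ∈ NN m n) : -f ∈ NN m n := by
  induction m generalizing n with
  | zero =>
    obtain ⟨T, rfl⟩ := hf
    exact ⟨-T, rfl⟩
  | succ m ih =>
    obtain ⟨w, T, g, hg, rfl⟩ := hf
    exact ⟨w, T, -g, ih hg, rfl⟩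

theorem NN.add {m n : ℕ} {f₁ f₂ : (Fin n → ℝ) → ℝ} (h₁ : f₁ ∈ NN m n) (h₂ : f₂ ∈ NN m n) :
    f₁ + f₂ ∈ NN m n := by
  induction m generalizing n with
  | zero =>
    obtain ⟨T₁, rfl⟩ := h₁
    obtain ⟨T₂, rfl⟩ := h₂
    exact ⟨T₁ + T₂, rfl⟩
  | succ m ih =>
    obtain ⟨w₁, T₁, g₁, hg₁, rfl⟩ := h₁
    obtain ⟨w₂, T₂, g₂, hg₂, rfl⟩ := h₂
    refine ⟨w₁ + w₂,
      AffineMap.pi (Fin.addCases (fun i => (AffineMap.proj i).comp T₁)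
        (fun i => (AffineMap.proj i).comp T₂)), _,
      ih (NN.comp_affineMap hg₁ (LinearMap.funLeft ℝ ℝ (Fin.castAdd w₂)).toAffineMap)
        (NN.comp_affineMap hg₂ (LinearMap.funLeft ℝ ℝ (Fin.natAdd w₁)).toAffineMap), ?_⟩
    funext x
    simp [LinearMap.funLeft, Function.comp_def]

theorem NN.subset_succ (m n : ℕ) : NN m n ⊆ NN (m + 1) n := by
  induction m generalizing n with
  | zero =>
    rintro _ ⟨T, rfl⟩
    refine ⟨2, AffineMap.pi ![T, -T], _,
      ⟨AffineMap.proj (k := ℝ) (P := fun _ : Fin 2 => ℝ) 0 - AffineMap.proj 1, rfl⟩, ?_⟩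
    funext x
    simp
  | succ m ih =>
    rintro _ ⟨w, T, g, hg, rfl⟩
    exact ⟨w, T, g, ih w hg, rfl⟩

theorem NN.mono (n : ℕ) : Monotone (NN · n) :=
  monotone_nat_of_le_succ fun m => NN.subset_succ m n

theorem MinDepth.le_of_mem {n m k : ℕ} {f : (Fin n → ℝ) → ℝ} (hf : MinDepth n f m)
    (hk : f ∈ NN k n) : m ≤ k := by
  rcases hf.2 with rfl | h
  · exact Nat.zero_le k
  · by_contra! hlt
    exact h (NN.mono n (Nat.le_sub_one_of_lt hlt) hk)

theorem NN.add_mem_max {n m₁ m₂ : ℕ} {f₁ f₂ : (Fin n → ℝ) → ℝ} (h₁ : f₁ ∈ NN m₁ n)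
    (h₂ : f₂ ∈ NN m₂ n) : f₁ + f₂ ∈ NN (max m₁ m₂) n :=
  NN.add (NN.mono n (le_max_left _ _) h₁) (NN.mono n (le_max_right _ _) h₂)

/-- If `f₁, f₂` are CPWL with minimal depths `m₁, m₂` and `f₁ + f₂` has minimal
depth `m`, then either `m = max m₁ m₂`, or `m ≤ m₁` and `m₁ = m₂`. -/
theorem statement3 (n m₁ m₂ m : ℕ) (f₁ f₂ : (Fin n → ℝ) → ℝ)
    (h₁ : f₁ ∈ CPWL n) (h₂ : f₂ ∈ CPWL n)
    (hm₁ : MinDepth n f₁ m₁) (hm₂ : MinDepth n f₂ m₂)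
    (hm : MinDepth n (f₁ + f₂) m) :
    m = max m₁ m₂ ∨ (m ≤ m₁ ∧ m₁ = m₂) := by
  have h : m ≤ max m₁ m₂ := hm.le_of_mem (NN.add_mem_max hm₁.1 hm₂.1)
  have h₁' : m₁ ≤ max m m₂ := hm₁.le_of_mem <| by
    simpa using NN.add_mem_max hm.1 (NN.neg hm₂.1)
  have h₂' : m₂ ≤ max m m₁ := hm₂.le_of_mem <| by
    simpa using NN.add_mem_max hm.1 (NN.neg hm₁.1)
  omega
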